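/- Let H ∈ (0, 1/2) and 0 ≤ s < t. Then the function u ↦ (s+t+2u)^{2H} − 2^{2H−1}((s+u)^{2H} + (t+u)^{2H}) is strictly monotone decreasing on [0, ∞). Consequently, for g_H(s,t) = −2^{2H−1}(s^{2H} + t^{2H}) + (s+t)^{2H} + (t−s)^{2H}, the map u ↦ g_H(s+u, t+u) is strictly decreasing on [0, ∞). -/

import Mathlib

/-- The increment variance `E[(ξ_t^H − ξ_s^H)²]` of a sub-fractional Brownian motion. -/
noncomputable def sfBmIncVar (H s t : ℝ) : ℝ :=
  -(2 : ℝ) ^ (2 * H - 1) * (s ^ (2 * H) + t ^ (2 * H)) + (s + t) ^ (2 * H) + (t - s) ^ (2 * H)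

theorem strictConvexOn_rpow_of_neg {q : ℝ} (hq : q < 0) :
    StrictConvexOn ℝ (Set.Ioi 0) fun x : ℝ => x ^ q := by
  refine strictConvexOn_of_deriv2_pos' (convex_Ioi 0)
    (fun x hx => (Real.continuousAt_rpow_const x q (Or.inl (ne_of_gt hx))).continuousWithinAt) ?_
  intro x (hx : 0 < x)
  have h : (deriv^[2] fun x : ℝ => x ^ q) x = q * ((q - 1) * x ^ (q - 1 - 1)) := by
    rw [Function.iterate_succ_apply, Function.iterate_one, Real.deriv_rpow_const',
      deriv_const_mul_field, Real.deriv_rpow_const]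
  rw [h, ← mul_assoc]
  exact mul_pos (mul_pos_of_neg_of_neg hq (by linarith)) (Real.rpow_pos_of_pos hx _)

theorem two_mul_add_rpow_lt_of_neg {q x y : ℝ} (hq : q < 0) (hx : 0 < x) (hy : 0 < y)
    (hxy : x ≠ y) : 2 * (x + y) ^ q < (2 : ℝ) ^ q * (x ^ q + y ^ q) := by
  have h := (strictConvexOn_rpow_of_neg hq).2 hx hy hxy (by norm_num : (0 : ℝ) < 1 / 2)
    (by norm_num : (0 : ℝ) < 1 / 2) (by norm_num)
  simp only [smul_eq_mul] at h
  have h2 : (0 : ℝ) < 2 ^ q := by positivity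
  have hm : (x + y) ^ q = 2 ^ q * (1 / 2 * x + 1 / 2 * y) ^ q := by
    rw [← Real.mul_rpow (by norm_num) (by positivity)]
    congr 1
    ring
  rw [hm]
  nlinarith

theorem sfBm_shifted_strictAntiOn {p s t : ℝ} (hp₀ : 0 < p) (hp₁ : p < 1) (hs : 0 ≤ s)
    (hst : s < t) :
    StrictAntiOn
      (fun u : ℝ => (s + t + 2 * u) ^ p - (2 : ℝ) ^ (p - 1) * ((s + u) ^ p + (t + u) ^ p))
      (Set.Ici (0 : ℝ)) := by
  refine strictAntiOn_of_deriv_neg (convex_Ici 0) (Continuous.continuousOn ?_) ?_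
  · have h (f : ℝ → ℝ) (hf : Continuous f) : Continuous fun u => f u ^ p :=
      hf.rpow_const fun _ => Or.inr hp₀.le
    exact (h _ (by fun_prop)).sub
      (continuous_const.mul ((h _ (by fun_prop)).add (h _ (by fun_prop))))
  · intro u hu
    rw [interior_Ici, Set.mem_Ioi] at hu
    have hsu : 0 < s + u := by linarith
    have htu : 0 < t + u := by linarith
    have hstu : 0 < s + t + 2 * u := by linarith
    have hd := ((((hasDerivAt_id' u).const_mul 2).const_add (s + t)).rpow_const (p := p)
      (Or.inl hstu.ne')).sub (((((hasDerivAt_id' u).const_add s).rpow_const (p := p)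
        (Or.inl hsu.ne')).add (((hasDerivAt_id' u).const_add t).rpow_const (p := p)
        (Or.inl htu.ne'))).const_mul ((2 : ℝ) ^ (p - 1)))
    refine hd.deriv.trans_lt ?_
    have key := two_mul_add_rpow_lt_of_neg (by linarith : p - 1 < 0) hsu htu (by linarith)
    rw [show s + u + (t + u) = s + t + 2 * u by ring] at key
    nlinarith

/-- For `H ∈ (0, 1/2)`, the shifted increment variance of the sfBm is strictly decreasing
in the shift. -/
theorem sfBm_shifted_increment_variance_strictAnti
    (H s t : ℝ) (hH : H ∈ Set.Ioo (0 : ℝ) (1 / 2)) (hs : 0 ≤ s) (hst : s < t) :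
    StrictAntiOn
      (fun u : ℝ => (s + t + 2 * u) ^ (2 * H)
        - (2 : ℝ) ^ (2 * H - 1) * ((s + u) ^ (2 * H) + (t + u) ^ (2 * H)))
      (Set.Ici (0 : ℝ)) ∧
    StrictAntiOn (fun u : ℝ => sfBmIncVar H (s + u) (t + u)) (Set.Ici (0 : ℝ)) := by
  have hanti := sfBm_shifted_strictAntiOn (p := 2 * H) (by linarith [hH.1]) (by linarith [hH.2])
    hs hst
  refine ⟨hanti, (hanti.add_const ((t - s) ^ (2 * H))).congr fun u _ => ?_⟩
  simp only [sfBmIncVar]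
  rw [show s + u + (t + u) = s + t + 2 * u by ring, show t + u - (s + u) = t - s by ring]
  ring
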